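/- Fix an integer J ≥ 1 and reals α > 0, Σ₀ > 0 and Ȳ. For x > 0, let P₁(x,·) denote the law of G / (Σ₀ + (J/2)·(Ȳ/(xJ+1) − Z/√(xJ+1))²), where G ~ Gamma(α + J/2, 1) and Z ~ N(0,1) are independent. Then for all positive x and y, d_TV(P₁(x,·), P₁(y,·)) ≤ J·|x − y|·(1 + |Ȳ|/√(2π)). -/

import Mathlib

open MeasureTheory ProbabilityTheory
open scoped ENNReal

/-- Total variation distance between two measures:
the supremum over measurable sets `A` of `|μ A - ν A|`. -/
noncomputable def tvDist {χ : Type*} [MeasurableSpace χ] (μ ν : Measure χ) : ℝ :=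
  ⨆ A : {s : Set χ // MeasurableSet s}, |(μ A.1).toReal - (ν A.1).toReal|

/-- The transition kernel `P₁(x,·)` of the Normal Gibbs sampler with `K = 1`:
the law of `G / (S₀ + (J/2)·(Ȳ/(xJ+1) − Z/√(xJ+1))²)` where
`G ~ Gamma(α + J/2, 1)` and `Z ~ N(0,1)` are independent. -/
noncomputable def gibbsP1 (J : ℕ) (α S₀ Ybar : ℝ) (x : ℝ) : Measure ℝ :=
  ((gammaMeasure (α + J / 2) 1).prod (gaussianReal 0 1)).map
    (fun gz => gz.1 /
      (S₀ + (J / 2) * (Ybar / (x * J + 1) - gz.2 / Real.sqrt (x * J + 1)) ^ 2))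

/-- A one-sided uniform bound on measurable sets between probability measures is two-sided. -/
lemma abs_real_sub_le_of_forall_sub_le {χ : Type*} [MeasurableSpace χ] {μ ν : Measure χ}
    [IsProbabilityMeasure μ] [IsProbabilityMeasure ν] {C : ℝ}
    (h : ∀ A, MeasurableSet A → μ.real A - ν.real A ≤ C) {A : Set χ} (hA : MeasurableSet A) :
    |μ.real A - ν.real A| ≤ C := by
  have h₁ := h A hA
  have h₂ := h Aᶜ hA.compl
  rw [probReal_compl_eq_one_sub hA, probReal_compl_eq_one_sub hA] at h₂
  exact abs_le.2 ⟨by linarith, h₁⟩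

lemma gaussianPDFReal_le (m : ℝ) (v : NNReal) (z : ℝ) :
    gaussianPDFReal m v z ≤ (√(2 * Real.pi * v))⁻¹ := by
  rw [gaussianPDFReal]
  refine mul_le_of_le_one_right (by positivity) (Real.exp_le_one_iff.2 ?_)
  rw [neg_div]
  exact neg_nonpos.2 (by positivity)

/-- Pointwise comparison of two Gaussian densities on a set compares the measures of the set. -/
lemma gaussianReal_real_mono {m₁ m₂ : ℝ} {v : NNReal} (hv : v ≠ 0) {A : Set ℝ}
    (hA : MeasurableSet A) (h : ∀ z ∈ A, (z - m₂) ^ 2 ≤ (z - m₁) ^ 2) :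
    (gaussianReal m₁ v).real A ≤ (gaussianReal m₂ v).real A := by
  refine ENNReal.toReal_mono (measure_ne_top _ _) ?_
  rw [gaussianReal_apply _ hv, gaussianReal_apply _ hv]
  refine setLIntegral_mono' hA fun z hz => ENNReal.ofReal_le_ofReal ?_
  rw [gaussianPDFReal, gaussianPDFReal]
  gcongr ?_ * Real.exp ?_
  rw [neg_div, neg_div]
  exact neg_le_neg (div_le_div_of_nonneg_right (h z hz) (by positivity))

lemma gaussianReal_Ioc_le {m : ℝ} {v : NNReal} (hv : v ≠ 0) {a b : ℝ} (hab : a ≤ b) :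
    (gaussianReal m v).real (Set.Ioc a b) ≤ (b - a) / √(2 * Real.pi * v) := by
  have hab' : 0 ≤ b - a := sub_nonneg.2 hab
  refine ENNReal.toReal_le_of_le_ofReal (by positivity) ?_
  rw [gaussianReal_apply _ hv]
  calc ∫⁻ z in Set.Ioc a b, gaussianPDF m v z
      ≤ ∫⁻ _ in Set.Ioc a b, ENNReal.ofReal (√(2 * Real.pi * v))⁻¹ :=
        lintegral_mono fun z => ENNReal.ofReal_le_ofReal (gaussianPDFReal_le m v z)
    _ = ENNReal.ofReal ((b - a) / √(2 * Real.pi * v)) := by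
        rw [setLIntegral_const, Real.volume_Ioc, ← ENNReal.ofReal_mul (by positivity), mul_comm,
          div_eq_mul_inv]

lemma gaussianReal_real_sub_le_of_mean_le {m₁ m₂ : ℝ} {v : NNReal} (hv : v ≠ 0) (hm : m₁ ≤ m₂)
    {A : Set ℝ} (hA : MeasurableSet A) :
    (gaussianReal m₁ v).real A - (gaussianReal m₂ v).real A
      ≤ (m₂ - m₁) / √(2 * Real.pi * v) := by
  set c := (m₁ + m₂) / 2 with hc
  set H : Set ℝ := Set.Iic c
  have hH : MeasurableSet H := measurableSet_Iic
  have h₁ : (gaussianReal m₁ v).real (A \ H) ≤ (gaussianReal m₂ v).real (A \ H) := by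
    refine gaussianReal_real_mono hv (hA.diff hH) fun z hz => ?_
    have : c < z := not_le.1 hz.2
    nlinarith
  have h₂ : (gaussianReal m₂ v).real (H \ A) ≤ (gaussianReal m₁ v).real (H \ A) := by
    refine gaussianReal_real_mono hv (hH.diff hA) fun z hz => ?_
    have : z ≤ c := hz.1
    nlinarith
  have h₃ : (gaussianReal m₂ v).real H = (gaussianReal m₁ v).real (Set.Iic (c - (m₂ - m₁))) := by
    have : gaussianReal m₂ v = (gaussianReal m₁ v).map (· + (m₂ - m₁)) := by
      rw [gaussianReal_map_add_const, add_sub_cancel]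
    rw [this, map_measureReal_apply (by fun_prop) hH]
    congr 1
    ext z
    simp [H, le_sub_iff_add_le]
  have h₄ : (gaussianReal m₁ v).real H ≤ (gaussianReal m₁ v).real (Set.Iic (c - (m₂ - m₁)))
      + (gaussianReal m₁ v).real (Set.Ioc (c - (m₂ - m₁)) c) := by
    rw [show H = _ from (Set.Iic_union_Ioc_eq_Iic (show c - (m₂ - m₁) ≤ c by linarith)).symm]
    exact measureReal_union_le _ _
  have h₅ := gaussianReal_Ioc_le (m := m₁) hv (show c - (m₂ - m₁) ≤ c by linarith)
  rw [sub_sub_cancel] at h₅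
  have e₁ := measureReal_inter_add_sdiff (μ := gaussianReal m₁ v) (s := A) hH
  have e₂ := measureReal_inter_add_sdiff (μ := gaussianReal m₂ v) (s := A) hH
  have e₃ := measureReal_inter_add_sdiff (μ := gaussianReal m₁ v) (s := H) hA
  have e₄ := measureReal_inter_add_sdiff (μ := gaussianReal m₂ v) (s := H) hA
  rw [Set.inter_comm] at e₃ e₄
  linarith

lemma abs_gaussianReal_real_sub_le_of_mean (m₁ m₂ : ℝ) {v : NNReal} (hv : v ≠ 0)
    {A : Set ℝ} (hA : MeasurableSet A) :
    |(gaussianReal m₁ v).real A - (gaussianReal m₂ v).real A|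
      ≤ |m₁ - m₂| / √(2 * Real.pi * v) := by
  rcases le_total m₁ m₂ with h | h
  · rw [abs_sub_comm m₁, abs_of_nonneg (sub_nonneg.2 h)]
    exact abs_real_sub_le_of_forall_sub_le
      (fun B hB => gaussianReal_real_sub_le_of_mean_le hv h hB) hA
  · rw [abs_sub_comm, abs_of_nonneg (sub_nonneg.2 h)]
    exact abs_real_sub_le_of_forall_sub_le
      (fun B hB => gaussianReal_real_sub_le_of_mean_le hv h hB) hA

lemma abs_gaussianReal_real_sub_le_of_variance (m : ℝ) {v w : NNReal} (hw : w ≠ 0) (hwv : w ≤ v)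
    {A : Set ℝ} (hA : MeasurableSet A) :
    |(gaussianReal m v).real A - (gaussianReal m w).real A| ≤ 1 - √(w / v) := by
  have hw₀ : (0 : ℝ) < w := by exact_mod_cast pos_iff_ne_zero.2 hw
  have hv₀ : (0 : ℝ) < v := hw₀.trans_le (by exact_mod_cast hwv)
  have hv : v ≠ 0 := by rintro rfl; simp at hv₀
  have hwv' : (w : ℝ) ≤ v := by exact_mod_cast hwv
  have hpdf (z : ℝ) : √(w / v) * gaussianPDFReal m w z ≤ gaussianPDFReal m v z := by
    rw [gaussianPDFReal, gaussianPDFReal, ← mul_assoc]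
    have : √(w / v : ℝ) * (√(2 * Real.pi * w))⁻¹ = (√(2 * Real.pi * v))⁻¹ := by
      rw [← Real.sqrt_inv, ← Real.sqrt_inv, ← Real.sqrt_mul (by positivity)]
      congr 1
      field_simp
    rw [this]
    refine mul_le_mul_of_nonneg_left (Real.exp_le_exp.2 ?_) (by positivity)
    rw [neg_div, neg_div]
    gcongr
  have hle {B : Set ℝ} (hB : MeasurableSet B) :
      √(w / v) * (gaussianReal m w).real B ≤ (gaussianReal m v).real B := by
    rw [measureReal_def, ← ENNReal.toReal_ofReal (Real.sqrt_nonneg (w / v : ℝ)),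
      ← ENNReal.toReal_mul]
    refine ENNReal.toReal_mono (measure_ne_top _ _) ?_
    rw [gaussianReal_apply _ hw, gaussianReal_apply _ hv,
      ← lintegral_const_mul _ (measurable_gaussianPDF m w)]
    refine setLIntegral_mono' hB fun z _ => ?_
    rw [gaussianPDF, gaussianPDF, ← ENNReal.ofReal_mul (Real.sqrt_nonneg _)]
    exact ENNReal.ofReal_le_ofReal (hpdf z)
  have hs : √(w / v : ℝ) ≤ 1 := Real.sqrt_le_one.2 ((div_le_one hv₀).2 hwv')
  rw [abs_sub_comm]
  refine abs_real_sub_le_of_forall_sub_le (fun B hB => ?_) hA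
  have h₁ := hle hB
  have h₂ : (gaussianReal m w).real B ≤ 1 := measureReal_le_one
  nlinarith

lemma abs_gaussianReal_real_sub_le (Y : ℝ) {a b : NNReal} (ha : 1 ≤ a) (hab : a ≤ b)
    {A : Set ℝ} (hA : MeasurableSet A) :
    |(gaussianReal (Y / a) a⁻¹).real A - (gaussianReal (Y / b) b⁻¹).real A|
      ≤ (b - a) * (1 + |Y| / √(2 * Real.pi)) := by
  have ha₁ : (1 : ℝ) ≤ a := by exact_mod_cast ha
  have hab' : (a : ℝ) ≤ b := by exact_mod_cast hab
  have ha₀ : (0 : ℝ) < a := by linarith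
  have hb₀ : (0 : ℝ) < b := by linarith
  have hna : a ≠ 0 := (zero_lt_one.trans_le ha).ne'
  have hnb : b ≠ 0 := (zero_lt_one.trans_le (ha.trans hab)).ne'
  have h₁ := abs_gaussianReal_real_sub_le_of_mean (Y / a) (Y / b) (inv_ne_zero hna) hA
  have h₂ := abs_gaussianReal_real_sub_le_of_variance (Y / b) (inv_ne_zero hnb)
    (inv_anti₀ (zero_lt_one.trans_le ha) hab) hA
  have hmean : |Y / a - Y / b| / √(2 * Real.pi * (a⁻¹ : NNReal))
      ≤ (b - a) * (|Y| / √(2 * Real.pi)) := by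
    have hY : |Y / a - Y / b| = |Y| * ((b - a) / (a * b)) := by
      rw [show Y / a - Y / b = Y * ((b - a) / (a * b)) by field_simp, abs_mul,
        abs_of_nonneg (div_nonneg (sub_nonneg.2 hab') (by positivity))]
    have hsqrt : √(a : ℝ) ≤ a * b := by
      have : √(a : ℝ) ≤ a := Real.sqrt_le_self_iff.2 (Or.inr ha₁)
      nlinarith
    have hfrac : √(a : ℝ) / (a * b) ≤ 1 := (div_le_one (by positivity)).2 hsqrt
    rw [hY, NNReal.coe_inv, Real.sqrt_mul (by positivity), Real.sqrt_inv]
    calc |Y| * ((b - a) / (a * b)) / (√(2 * Real.pi) * (√(a : ℝ))⁻¹)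
        = (b - a) * (|Y| / √(2 * Real.pi)) * (√(a : ℝ) / (a * b)) := by field_simp
      _ ≤ (b - a) * (|Y| / √(2 * Real.pi)) :=
          mul_le_of_le_one_right (mul_nonneg (sub_nonneg.2 hab') (by positivity)) hfrac
  have hvar : 1 - √(((b⁻¹ : NNReal) : ℝ) / (a⁻¹ : NNReal)) ≤ b - a := by
    have hr : ((b⁻¹ : NNReal) : ℝ) / (a⁻¹ : NNReal) = a / b := by
      rw [NNReal.coe_inv, NNReal.coe_inv]; field_simp
    have hle : (a / b : ℝ) ≤ 1 := (div_le_one hb₀).2 hab'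
    have hs : (a / b : ℝ) ≤ √(a / b) := Real.le_sqrt_of_sq_le (by
      have : (0 : ℝ) ≤ a / b := by positivity
      nlinarith)
    have hd : 1 - (a / b : ℝ) ≤ b - a := by
      rw [one_sub_div hb₀.ne']
      exact div_le_self (sub_nonneg.2 hab') (ha₁.trans hab')
    rw [hr]
    linarith
  have := abs_sub_le ((gaussianReal (Y / a) a⁻¹).real A) ((gaussianReal (Y / b) a⁻¹).real A)
    ((gaussianReal (Y / b) b⁻¹).real A)
  linarith

lemma gaussianReal_map_const_sub_div_sqrt (m : ℝ) (a : NNReal) :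
    (gaussianReal 0 1).map (fun z => m - z / √(a : ℝ)) = gaussianReal m a⁻¹ := by
  have h : (fun z : ℝ => m - z / √(a : ℝ)) = (m + ·) ∘ (-(√(a : ℝ))⁻¹ * ·) := by
    ext z
    simp only [Function.comp]
    ring
  rw [h, ← Measure.map_map (by fun_prop) (by fun_prop), gaussianReal_map_const_mul,
    gaussianReal_map_const_add]
  congr 1
  · simp
  · ext
    simp

/-- Mapping the product of a probability measure with either of two measures preserves a uniform
upper bound on their difference on measurable sets. -/
lemma map_prod_apply_le_add {α β χ : Type*} [MeasurableSpace α] [MeasurableSpace β]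
    [MeasurableSpace χ] {μ : Measure α} [IsProbabilityMeasure μ] {ν₁ ν₂ : Measure β}
    [SFinite ν₁] [SFinite ν₂] {C : ℝ≥0∞} (h : ∀ B, MeasurableSet B → ν₁ B ≤ ν₂ B + C)
    {f : α × β → χ} (hf : Measurable f) {A : Set χ} (hA : MeasurableSet A) :
    (μ.prod ν₁).map f A ≤ (μ.prod ν₂).map f A + C := by
  have hB := hf hA
  rw [Measure.map_apply hf hA, Measure.map_apply hf hA, Measure.prod_apply hB,
    Measure.prod_apply hB]
  calc ∫⁻ s, ν₁ (Prod.mk s ⁻¹' (f ⁻¹' A)) ∂μ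
      ≤ ∫⁻ s, (ν₂ (Prod.mk s ⁻¹' (f ⁻¹' A)) + C) ∂μ :=
        lintegral_mono fun s => h _ (measurable_prodMk_left hB)
    _ = _ := by rw [lintegral_add_right _ measurable_const]; simp

lemma gibbsP1_eq_map (J : ℕ) {α : ℝ} (hα : 0 < α) (S₀ Ybar : ℝ) {x : ℝ} {a : NNReal}
    (ha : (a : ℝ) = x * J + 1) :
    gibbsP1 J α S₀ Ybar x = ((gammaMeasure (α + J / 2) 1).prod (gaussianReal (Ybar / a) a⁻¹)).map
      (fun gw => gw.1 / (S₀ + (J / 2) * gw.2 ^ 2)) := by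
  have := isProbabilityMeasure_gammaMeasure (show 0 < α + J / 2 by positivity) one_pos
  have hmap := Measure.map_prod_map (gammaMeasure (α + J / 2) 1) (gaussianReal 0 1)
    measurable_id (show Measurable fun z : ℝ => Ybar / a - z / √(a : ℝ) by fun_prop)
  rw [Measure.map_id, gaussianReal_map_const_sub_div_sqrt] at hmap
  rw [hmap, Measure.map_map (by fun_prop) (by fun_prop), gibbsP1, ha]
  rfl

/-- `d_TV(P₁(x,·), P₁(y,·)) ≤ J·|x − y|·(1 + |Ȳ|/√(2π))` for
all positive `x, y`. -/
theorem stmt6 (J : ℕ) (hJ : 1 ≤ J) (α S₀ Ybar : ℝ) (hα : 0 < α) (hS₀ : 0 < S₀)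
    (x y : ℝ) (hx : 0 < x) (hy : 0 < y) :
    tvDist (gibbsP1 J α S₀ Ybar x) (gibbsP1 J α S₀ Ybar y)
      ≤ J * |x - y| * (1 + |Ybar| / Real.sqrt (2 * Real.pi)) := by
  have hprob := isProbabilityMeasure_gammaMeasure (show 0 < α + J / 2 by positivity) one_pos
  have hC : 0 ≤ J * |x - y| * (1 + |Ybar| / Real.sqrt (2 * Real.pi)) := by positivity
  obtain ⟨a, ha⟩ : ∃ a : NNReal, (a : ℝ) = x * J + 1 := ⟨⟨x * J + 1, by positivity⟩, rfl⟩
  obtain ⟨b, hb⟩ : ∃ b : NNReal, (b : ℝ) = y * J + 1 := ⟨⟨y * J + 1, by positivity⟩, rfl⟩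
  have ha₁ : 1 ≤ a := by
    rw [← NNReal.coe_le_coe, ha, NNReal.coe_one, le_add_iff_nonneg_left]; positivity
  have hb₁ : 1 ≤ b := by
    rw [← NNReal.coe_le_coe, hb, NNReal.coe_one, le_add_iff_nonneg_left]; positivity
  have hdist : J * |x - y| = |(a : ℝ) - b| := by
    rw [ha, hb, add_sub_add_right_eq_sub, ← sub_mul, abs_mul, Nat.abs_cast, mul_comm]
  have hgauss (B : Set ℝ) (hB : MeasurableSet B) :
      |(gaussianReal (Ybar / a) a⁻¹).real B - (gaussianReal (Ybar / b) b⁻¹).real B|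
        ≤ J * |x - y| * (1 + |Ybar| / Real.sqrt (2 * Real.pi)) := by
    rw [hdist]
    rcases le_total a b with hab | hab
    · rw [abs_sub_comm (a : ℝ), abs_of_nonneg (sub_nonneg.2 (NNReal.coe_le_coe.2 hab))]
      exact abs_gaussianReal_real_sub_le Ybar ha₁ hab hB
    · rw [abs_sub_comm, abs_of_nonneg (sub_nonneg.2 (NNReal.coe_le_coe.2 hab))]
      exact abs_gaussianReal_real_sub_le Ybar hb₁ hab hB
  rw [gibbsP1_eq_map J hα S₀ Ybar ha, gibbsP1_eq_map J hα S₀ Ybar hb]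
  have hf : Measurable fun gw : ℝ × ℝ => gw.1 / (S₀ + (J / 2) * gw.2 ^ 2) := by fun_prop
  have := Measure.isProbabilityMeasure_map
    (μ := (gammaMeasure (α + J / 2) 1).prod (gaussianReal (Ybar / a) a⁻¹)) hf.aemeasurable
  have := Measure.isProbabilityMeasure_map
    (μ := (gammaMeasure (α + J / 2) 1).prod (gaussianReal (Ybar / b) b⁻¹)) hf.aemeasurable
  refine Real.iSup_le (fun A => abs_real_sub_le_of_forall_sub_le (fun B hB => ?_) A.2) hC
  have hle := map_prod_apply_le_add (μ := gammaMeasure (α + J / 2) 1)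
    (ν₁ := gaussianReal (Ybar / a) a⁻¹) (ν₂ := gaussianReal (Ybar / b) b⁻¹)
    (C := ENNReal.ofReal (J * |x - y| * (1 + |Ybar| / Real.sqrt (2 * Real.pi))))
    (fun D hD => by
      have h := (abs_le.1 (hgauss D hD)).2
      rw [← ofReal_measureReal, ← ofReal_measureReal,
        ← ENNReal.ofReal_add measureReal_nonneg hC]
      exact ENNReal.ofReal_le_ofReal (by linarith)) hf hB
  rw [← ofReal_measureReal, ← ofReal_measureReal, ← ENNReal.ofReal_add measureReal_nonneg hC,
    ENNReal.ofReal_le_ofReal_iff (add_nonneg measureReal_nonneg hC)] at hle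
  linarith
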